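/- Let q ≥ 1 be an integer. Suppose ψ(·, t) ∈ 𝓕 for all t ∈ ℝ₊ and set ψ̄(·, t) := Υ(ψ(·, t)). Then the following two conditions are equivalent: (i) ψ(·, t) ∈ 𝒟^q for all t ∈ ℝ₊, each ψ_i belongs to C^q(ℝ₊², ℝ₊), and ∂_t ψ_i = − v_i^eff(∂_u ψ) ∂_u ψ_i holds on ℝ₊² for i = 1, …, I; (ii) ψ̄(·, t) ∈ 𝒟̄^q for all t ∈ ℝ₊, each ψ̄_i belongs to C^q(ℝ₊², ℝ₊), and ∂_t ψ̄_i = − i ∂_z ψ̄_i holds on ℝ₊² for i = 1, …, I. -/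

import Mathlib

open Set Filter

noncomputable section

/-- `f ∈ 𝒞`: continuous, non-decreasing, `ℝ₊`-valued on `ℝ₊`, with `f 0 = 0`. -/
def memC (f : ℝ → ℝ) : Prop :=
  ContinuousOn f (Ici 0) ∧ MonotoneOn f (Ici 0) ∧ f 0 = 0 ∧ ∀ u ∈ Ici (0:ℝ), 0 ≤ f u

/-- `f ∈ 𝒞^↑`: member of `𝒞` that is strictly increasing and tends to `∞` at `∞`. -/
def memCup (f : ℝ → ℝ) : Prop :=
  memC f ∧ StrictMonoOn f (Ici 0) ∧ Tendsto f atTop atTop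

/-- the soliton size associated with the index `i : Fin I`, namely `i+1`, as a real number. -/
def sz {I : ℕ} (i : Fin I) : ℝ := (i : ℕ) + 1

/-- the effective-distance (integrated slot density) function `φ_i`. -/
def phi {I : ℕ} (ψ : Fin I → ℝ → ℝ) (i : Fin I) (u : ℝ) : ℝ :=
  u - ∑ j, 2 * min (sz i) (sz j) * ψ j u

/-- the top effective-distance function `φ_I` (note `min (I, j) = j` for `j ≤ I`). -/
def phiTop {I : ℕ} (ψ : Fin I → ℝ → ℝ) (u : ℝ) : ℝ :=
  u - ∑ j, 2 * sz j * ψ j u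

/-- `ψ ∈ 𝓕`. -/
def memF {I : ℕ} (ψ : Fin I → ℝ → ℝ) : Prop :=
  (∀ i, memC (ψ i)) ∧ memCup (phiTop ψ)

/-- the inverse of `f : ℝ₊ → ℝ₊` (as a function `ℝ → ℝ` supported in domain `Ici 0`). -/
def rinv (f : ℝ → ℝ) : ℝ → ℝ := Function.invFunOn f (Ici 0)

/-- the effective scaling (scattering) map `Υ`. -/
def Upsilon {I : ℕ} (ψ : Fin I → ℝ → ℝ) : Fin I → ℝ → ℝ :=
  fun i => ψ i ∘ rinv (phi ψ i)

/-- `gammaK ψb k = γ_{I-k}`, defined by downward recursion from `γ_I = id`: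
`γ_i(z) = z + ∑_{j>i} 2(j-i) ψb_j (γ_j z)`. -/
def gammaK {I : ℕ} (ψb : Fin I → ℝ → ℝ) : ℕ → ℝ → ℝ
  | 0 => fun z => z
  | k + 1 => fun z =>
      z + ∑ m ∈ (Finset.range (k + 1)).attach,
        2 * (((k + 1 : ℕ) : ℝ) - ((m : ℕ) : ℝ)) *
          (if h : (m : ℕ) < I then
              ψb ⟨I - 1 - (m : ℕ), by omega⟩ (gammaK ψb (m : ℕ) z)
            else 0)
  termination_by k => k
  decreasing_by have hm := Finset.mem_range.mp m.2; omega

/-- `γ_i`, for `i = 0, 1, …, I`. -/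
def gam {I : ℕ} (ψb : Fin I → ℝ → ℝ) (i : ℕ) : ℝ → ℝ := gammaK ψb (I - i)

/-- the spatial reconstruction (inverse scattering) map `Γ`. -/
def Gamma {I : ℕ} (ψb : Fin I → ℝ → ℝ) : Fin I → ℝ → ℝ :=
  fun i => ψb i ∘ gam ψb ((i : ℕ) + 1) ∘ rinv (gam ψb 0)

/-- the free-evolution shift `θ_t`. -/
def theta {I : ℕ} (t : ℝ) (ψb : Fin I → ℝ → ℝ) : Fin I → ℝ → ℝ :=
  fun i z => ψb i (max (z - sz i * t) 0)

/-- `ψ ∈ 𝒟`: member of `𝓕` satisfying the density condition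
`∑_i i · sup_{u₁≠u₂} (ψ_i(u₁)-ψ_i(u₂))/(φ_i(u₁)-φ_i(u₂)) < 1/2`. -/
def memD {I : ℕ} (ψ : Fin I → ℝ → ℝ) : Prop :=
  memF ψ ∧
  ∃ c : Fin I → ℝ,
    (∀ i, ∀ u₁ ∈ Ici (0:ℝ), ∀ u₂ ∈ Ici (0:ℝ), u₂ < u₁ →
      ψ i u₁ - ψ i u₂ ≤ c i * (phi ψ i u₁ - phi ψ i u₂)) ∧
    ∑ i, sz i * c i < 1 / 2

/-- `ψb ∈ 𝒟̄`: member of `𝒞^I` satisfying the density condition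
`∑_i i · sup_{z₁≠z₂} (ψb_i(z₁)-ψb_i(z₂))/(z₁-z₂) < 1/2`. -/
def memDbar {I : ℕ} (ψb : Fin I → ℝ → ℝ) : Prop :=
  (∀ i, memC (ψb i)) ∧
  ∃ c : Fin I → ℝ,
    (∀ i, ∀ z₁ ∈ Ici (0:ℝ), ∀ z₂ ∈ Ici (0:ℝ), z₂ < z₁ →
      ψb i z₁ - ψb i z₂ ≤ c i * (z₁ - z₂)) ∧
    ∑ i, sz i * c i < 1 / 2

/-- the extension `f^ℝ` of `f` to `ℝ`, by `0` on the negative half-line. -/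
def extZ (f : ℝ → ℝ) : ℝ → ℝ := fun u => if 0 ≤ u then f u else 0

/-- the extension `f^{ℝ,↑}` of `f` to `ℝ`, by the identity on the negative half-line. -/
def extId (f : ℝ → ℝ) : ℝ → ℝ := fun u => if 0 ≤ u then f u else u

/-- `f ∈ 𝒞^q`. -/
def memCq (q : ℕ) (f : ℝ → ℝ) : Prop := memC f ∧ ContDiff ℝ q (extZ f)

/-- `f ∈ 𝒞^{↑,q}`. -/
def memCupq (q : ℕ) (f : ℝ → ℝ) : Prop := memCup f ∧ ContDiff ℝ q (extId f)

/-- `f ∈ C^q(ℝ₊², ℝ₊)`: `ℝ₊`-valued and `q`-times continuously differentiable on the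
quadrant (one-sided at the boundary). -/
def memCqTwo (q : ℕ) (f : ℝ → ℝ → ℝ) : Prop :=
  (∀ u ∈ Ici (0:ℝ), ∀ t ∈ Ici (0:ℝ), 0 ≤ f u t) ∧
  ContDiffOn ℝ q (fun p : ℝ × ℝ => f p.1 p.2) (Ici 0 ×ˢ Ici 0)

/-- the matrix `M(ρ)`. -/
def Mmat {I : ℕ} (ρ : Fin I → ℝ) : Matrix (Fin I) (Fin I) ℝ :=
  Matrix.of fun i j =>
    if i = j then 1 - ∑ k ∈ Finset.univ.erase i, 2 * min (sz i) (sz k) * ρ k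
    else 2 * min (sz i) (sz j) * ρ j

/-- the effective speeds `v^eff(ρ) = M(ρ)⁻¹ v`, where `v_i = i`. -/
def veff {I : ℕ} (ρ : Fin I → ℝ) : Fin I → ℝ :=
  ((Mmat ρ)⁻¹).mulVec fun i => sz i

/-- `ρ ∈ 𝒟_density`. -/
def memDdensity {I : ℕ} (ρ : Fin I → ℝ → ℝ) : Prop :=
  (∀ i, (∀ u ∈ Ici (0:ℝ), 0 ≤ ρ i u) ∧ ContDiff ℝ 1 (extZ (ρ i))) ∧
  (∀ u ∈ Ici (0:ℝ), ∑ i, 2 * sz i * ρ i u < 1) ∧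
  ∃ c : Fin I → ℝ,
    (∀ i, ∀ u ∈ Ici (0:ℝ),
      ρ i u ≤ c i * (1 - ∑ j, 2 * min (sz i) (sz j) * ρ j u)) ∧
    ∑ i, sz i * c i < 1 / 2

theorem ContDiffOn.of_rightInverse {E F : Type*} [NormedAddCommGroup E] [NormedSpace ℝ E]
    [CompleteSpace E] [NormedAddCommGroup F] [NormedSpace ℝ F] {f : E → F} {g : F → E}
    {s : Set E} {t : Set F} {n : ℕ} (hs : UniqueDiffOn ℝ s) (ht : UniqueDiffOn ℝ t)
    (hf : ContDiffOn ℝ n f s) (hg : ContinuousOn g t) (hgm : MapsTo g t s)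
    (hfg : ∀ y ∈ t, f (g y) = y)
    (hinv : ∀ x ∈ s, ∃ e : E ≃L[ℝ] F, HasFDerivWithinAt f (e : E →L[ℝ] F) s x) :
    ContDiffOn ℝ n g t := by
  have hder : ∀ y ∈ t, HasFDerivWithinAt g
      (ContinuousLinearMap.inverse (fderivWithin ℝ f s (g y))) t y := by
    intro y hy
    obtain ⟨e, he⟩ := hinv _ (hgm hy)
    rw [he.fderivWithin (hs _ (hgm hy)), ContinuousLinearMap.inverse_equiv]
    refine HasFDerivWithinAt.of_local_left_inverse ?_ he hy ?_
    · exact tendsto_nhdsWithin_iff.2 ⟨hg y hy, eventually_mem_nhdsWithin.mono hgm⟩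
    · exact eventually_mem_nhdsWithin.mono hfg
  suffices ∀ m : ℕ, m ≤ n → ContDiffOn ℝ m g t from this n le_rfl
  intro m
  induction m with
  | zero => intro _; exact_mod_cast contDiffOn_zero.2 hg
  | succ m ih =>
    intro hm
    have hgm' := ih (by omega)
    push_cast
    refine (contDiffOn_succ_iff_hasFDerivWithinAt_of_uniqueDiffOn ht).2
      ⟨by simp, fun y => ContinuousLinearMap.inverse (fderivWithin ℝ f s (g y)), ?_, hder⟩
    have h1 : ContDiffOn ℝ m (fun y => fderivWithin ℝ f s (g y)) t :=
      (hf.fderivWithin hs (by exact_mod_cast hm)).comp hgm' hgm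
    intro y hy
    obtain ⟨e, he⟩ := hinv _ (hgm hy)
    have h2 : ContDiffAt ℝ m ContinuousLinearMap.inverse (fderivWithin ℝ f s (g y)) := by
      rw [he.fderivWithin (hs _ (hgm hy))]
      exact contDiffAt_map_inverse e
    exact h2.comp_contDiffWithinAt y (h1 y hy)

theorem continuousOn_parametric_inverse {A T : Set ℝ} (hA : IsUpperSet A) {F G : ℝ → ℝ → ℝ}
    (hF : ContinuousOn (fun p : ℝ × ℝ => F p.1 p.2) (A ×ˢ T))
    (hmono : ∀ t ∈ T, StrictMonoOn (fun x => F x t) A)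
    (hGm : ∀ t ∈ T, ∀ z ∈ A, G z t ∈ A) (hFG : ∀ t ∈ T, ∀ z ∈ A, F (G z t) t = z) :
    ContinuousOn (fun p : ℝ × ℝ => G p.1 p.2) (A ×ˢ T) := by
  rintro ⟨z, t⟩ ⟨hz, ht⟩
  simp only at hz ht
  have key : ∀ a ∈ A, Tendsto (fun p : ℝ × ℝ => F a p.2 - p.1) (nhdsWithin (z, t) (A ×ˢ T))
      (nhds (F a t - z)) := by
    intro a ha
    have : ContinuousOn (fun p : ℝ × ℝ => F a p.2 - p.1) (A ×ˢ T) := by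
      refine ContinuousOn.sub ?_ continuousOn_fst
      exact hF.comp (f := fun p : ℝ × ℝ => (a, p.2)) (by fun_prop) fun p hp => ⟨ha, hp.2⟩
    exact this (z, t) ⟨hz, ht⟩
  refine tendsto_order.2 ⟨fun a ha => ?_, fun b hb => ?_⟩
  · by_cases haA : a ∈ A
    · have h1 := hmono t ht haA (hGm t ht z hz) ha
      simp only [hFG t ht z hz] at h1
      filter_upwards [(key a haA).eventually (gt_mem_nhds (sub_neg.2 h1)),
        eventually_mem_nhdsWithin] with p hp hpm
      rw [sub_neg] at hp
      by_contra! hle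
      have := (hmono p.2 hpm.2).monotoneOn (hGm _ hpm.2 _ hpm.1) haA hle
      simp only [hFG _ hpm.2 _ hpm.1] at this
      linarith
    · filter_upwards [eventually_mem_nhdsWithin] with p hpm
      by_contra! hle
      exact haA (hA hle (hGm _ hpm.2 _ hpm.1))
  · have hbA : b ∈ A := hA hb.le (hGm t ht z hz)
    have h1 := hmono t ht (hGm t ht z hz) hbA hb
    simp only [hFG t ht z hz] at h1
    filter_upwards [(key b hbA).eventually (lt_mem_nhds (sub_pos.2 h1)),
      eventually_mem_nhdsWithin] with p hp hpm
    rw [sub_pos] at hp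
    by_contra! hle
    have := (hmono p.2 hpm.2).monotoneOn hbA (hGm _ hpm.2 _ hpm.1) hle
    simp only [hFG _ hpm.2 _ hpm.1] at this
    linarith

theorem HasFDerivWithinAt.hasDerivWithinAt_fst {A T : Set ℝ} {F : ℝ → ℝ → ℝ}
    {L : ℝ × ℝ →L[ℝ] ℝ} {u t : ℝ} (ht : t ∈ T)
    (h : HasFDerivWithinAt (fun p : ℝ × ℝ => F p.1 p.2) L (A ×ˢ T) (u, t)) :
    HasDerivWithinAt (fun w => F w t) (L (1, 0)) A u := by
  have h1 : HasDerivWithinAt (fun w : ℝ => (w, t)) ((1 : ℝ), (0 : ℝ)) A u :=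
    (hasDerivWithinAt_id u A).prodMk (hasDerivWithinAt_const u A t)
  exact HasFDerivWithinAt.comp_hasDerivWithinAt (f := fun w : ℝ => (w, t)) u h h1
    fun w hw => ⟨hw, ht⟩

theorem HasFDerivWithinAt.hasDerivWithinAt_snd {A T : Set ℝ} {F : ℝ → ℝ → ℝ}
    {L : ℝ × ℝ →L[ℝ] ℝ} {u t : ℝ} (hu : u ∈ A)
    (h : HasFDerivWithinAt (fun p : ℝ × ℝ => F p.1 p.2) L (A ×ˢ T) (u, t)) :
    HasDerivWithinAt (fun s => F u s) (L (0, 1)) T t := by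
  have h1 : HasDerivWithinAt (fun s : ℝ => (u, s)) ((0 : ℝ), (1 : ℝ)) T t :=
    (hasDerivWithinAt_const t T u).prodMk (hasDerivWithinAt_id t T)
  exact HasFDerivWithinAt.comp_hasDerivWithinAt (f := fun s : ℝ => (u, s)) t h h1
    fun w hw => ⟨hu, hw⟩

theorem contDiffOn_parametric_inverse {A T : Set ℝ} (hA : IsUpperSet A)
    (hAd : UniqueDiffOn ℝ A) (hTd : UniqueDiffOn ℝ T) {F G : ℝ → ℝ → ℝ} {n : ℕ} (hn : 1 ≤ n)
    (hF : ContDiffOn ℝ n (fun p : ℝ × ℝ => F p.1 p.2) (A ×ˢ T))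
    (hmono : ∀ t ∈ T, StrictMonoOn (fun x => F x t) A)
    (hne : ∀ t ∈ T, ∀ x ∈ A, derivWithin (fun w => F w t) A x ≠ 0)
    (hGm : ∀ t ∈ T, ∀ z ∈ A, G z t ∈ A) (hFG : ∀ t ∈ T, ∀ z ∈ A, F (G z t) t = z) :
    ContDiffOn ℝ n (fun p : ℝ × ℝ => G p.1 p.2) (A ×ˢ T) := by
  have hU := hAd.prod hTd
  have hn' : (n : WithTop ℕ∞) ≠ 0 := by exact_mod_cast (by omega : n ≠ 0)
  have hGc := continuousOn_parametric_inverse hA hF.continuousOn hmono hGm hFG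
  have key : ContDiffOn ℝ n (fun p : ℝ × ℝ => (G p.1 p.2, p.2)) (A ×ˢ T) := by
    refine ContDiffOn.of_rightInverse (f := fun p : ℝ × ℝ => (F p.1 p.2, p.2)) hU hU
      (hF.prodMk contDiffOn_snd) (hGc.prodMk continuousOn_snd)
      (fun p hp => ⟨hGm _ hp.2 _ hp.1, hp.2⟩) (fun p hp => Prod.ext (hFG _ hp.2 _ hp.1) rfl) ?_
    rintro ⟨x, t⟩ ⟨hx, ht⟩
    have hd := (hF.differentiableOn hn' (x, t) ⟨hx, ht⟩).hasFDerivWithinAt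
    set L := fderivWithin ℝ (fun p : ℝ × ℝ => F p.1 p.2) (A ×ˢ T) (x, t)
    have ha : L (1, 0) ≠ 0 := by
      rw [← (hd.hasDerivWithinAt_fst ht).derivWithin (hAd x hx)]
      exact hne t ht x hx
    have hL : ∀ p : ℝ × ℝ, L p = p.1 * L (1, 0) + p.2 * L (0, 1) := by
      intro p
      conv_lhs => rw [show p = p.1 • ((1 : ℝ), (0 : ℝ)) + p.2 • ((0 : ℝ), (1 : ℝ)) by
        ext <;> simp]
      simp only [map_add, map_smul, smul_eq_mul]
    let e : (ℝ × ℝ) ≃L[ℝ] (ℝ × ℝ) := ContinuousLinearEquiv.equivOfInverse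
      (L.prod (ContinuousLinearMap.snd ℝ ℝ ℝ))
      (((L (1, 0))⁻¹ • (ContinuousLinearMap.fst ℝ ℝ ℝ -
        L (0, 1) • ContinuousLinearMap.snd ℝ ℝ ℝ)).prod (ContinuousLinearMap.snd ℝ ℝ ℝ))
      (fun p => by
        ext
        · simp only [ContinuousLinearMap.prod_apply, smul_apply,
            sub_apply, ContinuousLinearMap.coe_fst',
            ContinuousLinearMap.coe_snd', smul_eq_mul, hL p]
          field_simp
          ring
        · simp)
      (fun p => by
        ext
        · simp only [ContinuousLinearMap.prod_apply, smul_apply,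
            sub_apply, ContinuousLinearMap.coe_fst',
            ContinuousLinearMap.coe_snd', smul_eq_mul]
          rw [hL]
          field_simp
          ring
        · simp)
    exact ⟨e, hd.prodMk hasFDerivWithinAt_snd⟩
  exact contDiff_fst.comp_contDiffOn key

theorem sz_pos {I : ℕ} (i : Fin I) : 0 < sz i := by
  unfold sz; positivity

theorem sz_le_sz {I : ℕ} {i j : Fin I} (h : i ≤ j) : sz i ≤ sz j := by
  unfold sz
  have : (i : ℕ) ≤ j := h
  gcongr

theorem min_sz_eq_sum {I : ℕ} (i j : Fin I) :
    min (sz i) (sz j) = ∑ k : Fin I, (if k ≤ i then (1 : ℝ) else 0) * (if k ≤ j then 1 else 0) := by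
  have h : ∀ k : Fin I, (if k ≤ i then (1 : ℝ) else 0) * (if k ≤ j then 1 else 0) =
      if k ∈ Finset.Iic (min i j) then 1 else 0 := by
    intro k
    by_cases h1 : k ≤ i <;> by_cases h2 : k ≤ j <;> simp [h1, h2]
  simp_rw [h]
  rw [Finset.sum_ite_mem, Finset.univ_inter, Finset.sum_const, Fin.card_Iic, nsmul_one]
  rcases le_total i j with hij | hij
  · rw [min_eq_left hij, min_eq_left (sz_le_sz hij)]; simp [sz]
  · rw [min_eq_right hij, min_eq_right (sz_le_sz hij)]; simp [sz]

theorem sum_min_sz_mul_nonneg {I : ℕ} (y : Fin I → ℝ) :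
    0 ≤ ∑ i, y i * ∑ j, 2 * min (sz i) (sz j) * y j := by
  have h : ∑ i, y i * ∑ j, 2 * min (sz i) (sz j) * y j =
      ∑ k : Fin I, 2 * (∑ i, (if k ≤ i then (1 : ℝ) else 0) * y i) ^ 2 := by
    simp_rw [min_sz_eq_sum, sq, Finset.sum_mul_sum, Finset.mul_sum, Finset.sum_mul]
    simp_rw [Finset.mul_sum]
    conv_rhs => rw [Finset.sum_comm]
    refine Finset.sum_congr rfl fun i _ => ?_
    conv_rhs => rw [Finset.sum_comm]
    refine Finset.sum_congr rfl fun j _ => Finset.sum_congr rfl fun k _ => ?_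
    ring
  rw [h]
  positivity

theorem Mmat_mulVec {I : ℕ} (ρ x : Fin I → ℝ) (i : Fin I) :
    (Mmat ρ).mulVec x i = (1 - ∑ j, 2 * min (sz i) (sz j) * ρ j) * x i +
      ∑ j, 2 * min (sz i) (sz j) * (ρ j * x j) := by
  rw [Matrix.mulVec, dotProduct, ← Finset.add_sum_erase _ _ (Finset.mem_univ i),
    ← Finset.add_sum_erase _ (fun j => 2 * min (sz i) (sz j) * ρ j) (Finset.mem_univ i),
    ← Finset.add_sum_erase _ (fun j => 2 * min (sz i) (sz j) * (ρ j * x j)) (Finset.mem_univ i)]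
  have h : ∑ j ∈ Finset.univ.erase i, Mmat ρ i j * x j =
      ∑ j ∈ Finset.univ.erase i, 2 * min (sz i) (sz j) * (ρ j * x j) := by
    refine Finset.sum_congr rfl fun j hj => ?_
    have hne : i ≠ j := (Finset.ne_of_mem_erase hj).symm
    simp only [Mmat, Matrix.of_apply, if_neg hne]
    ring
  rw [h]
  simp only [Mmat, Matrix.of_apply, if_true]
  ring

theorem isUnit_det_Mmat {I : ℕ} {ρ : Fin I → ℝ} (hρ : ∀ i, 0 ≤ ρ i)
    (hP : ∀ i : Fin I, 0 < 1 - ∑ j, 2 * min (sz i) (sz j) * ρ j) : IsUnit (Mmat ρ).det := by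
  rw [← Matrix.isUnit_iff_isUnit_det, ← Matrix.mulVec_injective_iff_isUnit,
    ← Matrix.coe_mulVecLin, ← LinearMap.ker_eq_bot, LinearMap.ker_eq_bot']
  intro x hx
  have hx' : ∀ i, (1 - ∑ j, 2 * min (sz i) (sz j) * ρ j) * x i +
      ∑ j, 2 * min (sz i) (sz j) * (ρ j * x j) = 0 := by
    intro i
    rw [← Mmat_mulVec, ← Matrix.mulVecLin_apply, hx, Pi.zero_apply]
  have hsum : ∑ i, (1 - ∑ j, 2 * min (sz i) (sz j) * ρ j) * (ρ i * x i ^ 2) +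
      ∑ i, ρ i * x i * ∑ j, 2 * min (sz i) (sz j) * (ρ j * x j) = 0 := by
    rw [← Finset.sum_add_distrib]
    refine Finset.sum_eq_zero fun i _ => ?_
    linear_combination ρ i * x i * hx' i
  have hnn : ∀ i ∈ Finset.univ,
      0 ≤ (1 - ∑ j, 2 * min (sz i) (sz j) * ρ j) * (ρ i * x i ^ 2) := fun i _ =>
    mul_nonneg (hP i).le (mul_nonneg (hρ i) (sq_nonneg _))
  have h0 := (Finset.sum_eq_zero_iff_of_nonneg hnn).1 (le_antisymm
    (by linarith [sum_min_sz_mul_nonneg fun i => ρ i * x i]) (Finset.sum_nonneg hnn))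
  have hy : ∀ i, ρ i * x i = 0 := by
    intro i
    have := (mul_eq_zero.1 (h0 i (Finset.mem_univ i))).resolve_left (hP i).ne'
    rcases mul_eq_zero.1 this with h | h
    · rw [h, zero_mul]
    · rw [pow_eq_zero_iff two_ne_zero] at h
      rw [h, mul_zero]
  funext i
  have := hx' i
  simp only [hy, mul_zero, Finset.sum_const_zero, add_zero] at this
  exact (mul_eq_zero.1 this).resolve_left (hP i).ne'

theorem eq_neg_veff_mul_iff {I : ℕ} {ρ w a b : Fin I → ℝ} (hρ : ∀ i, 0 ≤ ρ i)
    (hP : ∀ i : Fin I, 0 < 1 - ∑ j, 2 * min (sz i) (sz j) * ρ j)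
    (ha : ∀ i, ρ i = a i * (1 - ∑ j, 2 * min (sz i) (sz j) * ρ j))
    (hb : ∀ i, w i = a i * (-∑ j, 2 * min (sz i) (sz j) * w j) + b i) :
    (∀ i, w i = -veff ρ i * ρ i) ↔ ∀ i, b i = -sz i * a i := by
  have hdet := isUnit_det_Mmat hρ hP
  constructor
  · intro h i
    have hM : (Mmat ρ).mulVec (veff ρ) i = sz i := by
      rw [veff, Matrix.mulVec_mulVec, Matrix.mul_nonsing_inv _ hdet, Matrix.one_mulVec]
    rw [Mmat_mulVec] at hM
    have hw : ∑ j, 2 * min (sz i) (sz j) * w j =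
        -∑ j, 2 * min (sz i) (sz j) * (ρ j * veff ρ j) := by
      rw [← Finset.sum_neg_distrib]
      refine Finset.sum_congr rfl fun j _ => ?_
      rw [h j]; ring
    have h1 := hb i
    rw [hw, h i] at h1
    linear_combination -h1 - a i * hM - veff ρ i * ha i
  · intro h
    set v : Fin I → ℝ := fun i => (sz i + ∑ j, 2 * min (sz i) (sz j) * w j) /
      (1 - ∑ j, 2 * min (sz i) (sz j) * ρ j)
    have hvP : ∀ i, (1 - ∑ j, 2 * min (sz i) (sz j) * ρ j) * v i =
        sz i + ∑ j, 2 * min (sz i) (sz j) * w j := fun i => mul_div_cancel₀ _ (hP i).ne'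
    have hwv : ∀ i, w i = -v i * ρ i := by
      intro i
      linear_combination hb i + h i + v i * ha i + a i * hvP i
    have hM : (Mmat ρ).mulVec v = fun i => sz i := by
      funext i
      rw [Mmat_mulVec, hvP]
      have hw : ∑ j, 2 * min (sz i) (sz j) * w j =
          -∑ j, 2 * min (sz i) (sz j) * (ρ j * v j) := by
        rw [← Finset.sum_neg_distrib]
        refine Finset.sum_congr rfl fun j _ => ?_
        rw [hwv j]; ring
      rw [hw]; ring
    have : veff ρ = v := by
      rw [veff, ← hM, Matrix.mulVec_mulVec, Matrix.nonsing_inv_mul _ hdet, Matrix.one_mulVec]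
    rw [this]
    exact hwv

theorem one_sub_sum_min_sz_mul_pos {I : ℕ} {r c : Fin I → ℝ} (hr : ∀ i, 0 ≤ r i)
    (hc : ∀ i, 0 ≤ c i) (hrc : ∀ i, r i ≤ c i * (1 - ∑ j, 2 * min (sz i) (sz j) * r j))
    (i : Fin I) : 0 < 1 - ∑ j, 2 * min (sz i) (sz j) * r j := by
  by_contra! hi
  have htop : 1 - ∑ j, 2 * sz j * r j ≤ 0 := by
    refine le_trans (sub_le_sub_left (Finset.sum_le_sum fun j _ => ?_) _) hi
    have := hr j
    gcongr
    exact min_le_right _ _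
  have hzero : ∀ n : ℕ, ∀ k : Fin I, I - k ≤ n → r k = 0 := by
    intro n
    induction n with
    | zero => intro k hk; omega
    | succ n ih =>
      intro k hk
      have hsum : ∑ j, 2 * min (sz k) (sz j) * r j = ∑ j, 2 * sz j * r j := by
        refine Finset.sum_congr rfl fun j _ => ?_
        rcases le_or_gt j k with hjk | hjk
        · rw [min_eq_right (sz_le_sz hjk)]
        · rw [ih j (by have : (k : ℕ) < j := hjk; omega), mul_zero, mul_zero]
      refine le_antisymm ((hrc k).trans ?_) (hr k)
      rw [hsum]
      exact mul_nonpos_of_nonneg_of_nonpos (hc k) htop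
  have : ∑ j, 2 * sz j * r j = 0 :=
    Finset.sum_eq_zero fun j _ => by rw [hzero I j (by omega), mul_zero]
  linarith

/-- Spatial scattering data on a half-line or the whole line `A`: the functions `ψb i` express
`ψ i` in the coordinate `phi ψ i`, and all the effective-distance functions are bijections of
`A`. -/
structure Scattering {I : ℕ} (A : Set ℝ) (ψ ψb : Fin I → ℝ → ℝ) : Prop where
  mono : ∀ i, MonotoneOn (ψ i) A
  strict_top : StrictMonoOn (phiTop ψ) A
  mapsTo_top : MapsTo (phiTop ψ) A A
  surjOn_top : SurjOn (phiTop ψ) A A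
  mapsTo : ∀ i, MapsTo (phi ψ i) A A
  surjOn : ∀ i, SurjOn (phi ψ i) A A
  comp : ∀ i, ∀ u ∈ A, ψb i (phi ψ i u) = ψ i u

theorem phi_eq_phiTop_add {I : ℕ} (ψ : Fin I → ℝ → ℝ) (i : Fin I) (u : ℝ) :
    phi ψ i u = phiTop ψ u + ∑ j, 2 * (sz j - min (sz i) (sz j)) * ψ j u := by
  unfold phi phiTop
  rw [sub_add, ← Finset.sum_sub_distrib]
  congr 1
  exact Finset.sum_congr rfl fun j _ => by ring

theorem sz_sub_min_nonneg {I : ℕ} (i j : Fin I) : 0 ≤ sz j - min (sz i) (sz j) :=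
  sub_nonneg.2 (min_le_right _ _)

theorem strictMonoOn_phi {I : ℕ} {A : Set ℝ} {ψ : Fin I → ℝ → ℝ}
    (hm : ∀ i, MonotoneOn (ψ i) A) (hs : StrictMonoOn (phiTop ψ) A) (i : Fin I) :
    StrictMonoOn (phi ψ i) A := by
  intro x hx y hy hxy
  rw [phi_eq_phiTop_add, phi_eq_phiTop_add]
  refine add_lt_add_of_lt_of_le (hs hx hy hxy) (Finset.sum_le_sum fun j _ => ?_)
  have := sz_sub_min_nonneg i j
  have := hm j hx hy hxy.le
  gcongr

theorem Scattering.strict {I : ℕ} {A : Set ℝ} {ψ ψb : Fin I → ℝ → ℝ} (h : Scattering A ψ ψb)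
    (i : Fin I) : StrictMonoOn (phi ψ i) A :=
  strictMonoOn_phi h.mono h.strict_top i

theorem memCup.surjOn {f : ℝ → ℝ} (h : memCup f) : SurjOn f (Ici 0) (Ici 0) := by
  intro z hz
  obtain ⟨b, hb0, hb⟩ : ∃ b, 0 ≤ b ∧ z ≤ f b :=
    ((eventually_ge_atTop 0).and (h.2.2.eventually_ge_atTop z)).exists
  obtain ⟨x, hx, hfx⟩ := intermediate_value_Icc hb0 (h.1.1.mono Icc_subset_Ici_self)
    (show z ∈ Icc (f 0) (f b) from ⟨by rw [h.1.2.2.1]; exact hz, hb⟩)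
  exact ⟨x, hx.1, hfx⟩

theorem memF.memCup_phi {I : ℕ} {ψ : Fin I → ℝ → ℝ} (h : memF ψ) (i : Fin I) :
    memCup (phi ψ i) := by
  have hs := strictMonoOn_phi (fun i => (h.1 i).2.1) h.2.2.1 i
  have hle : ∀ u ∈ Ici (0 : ℝ), phiTop ψ u ≤ phi ψ i u := fun u hu => by
    rw [phi_eq_phiTop_add]
    exact le_add_of_nonneg_right (Finset.sum_nonneg fun j _ =>
      mul_nonneg (mul_nonneg zero_le_two (sz_sub_min_nonneg i j)) ((h.1 j).2.2.2 u hu))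
  refine ⟨⟨?_, hs.monotoneOn, ?_, fun u hu => (h.2.1.2.2.2 u hu).trans (hle u hu)⟩, hs, ?_⟩
  · exact continuousOn_id.sub (continuousOn_finsetSum _ fun j _ =>
      continuousOn_const.mul (h.1 j).1)
  · simp [phi, fun j => (h.1 j).2.2.1]
  · exact tendsto_atTop_mono' _ ((eventually_ge_atTop 0).mono hle) h.2.2.2

theorem memF.scattering {I : ℕ} {ψ ψb : Fin I → ℝ → ℝ} (h : memF ψ)
    (hψb : ∀ i z, ψb i z = Upsilon ψ i z) : Scattering (Ici 0) ψ ψb where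
  mono i := (h.1 i).2.1
  strict_top := h.2.2.1
  mapsTo_top := h.2.1.2.2.2
  surjOn_top := h.2.surjOn
  mapsTo i := (h.memCup_phi i).1.2.2.2
  surjOn i := (h.memCup_phi i).surjOn
  comp i u hu := by
    rw [hψb, Upsilon, Function.comp_apply, rinv,
      (h.memCup_phi i).2.1.injOn.leftInvOn_invFunOn hu]

theorem extZ_of_nonneg {f : ℝ → ℝ} {u : ℝ} (h : 0 ≤ u) : extZ f u = f u := if_pos h

theorem extZ_of_neg {f : ℝ → ℝ} {u : ℝ} (h : u < 0) : extZ f u = 0 := if_neg h.not_ge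

theorem phi_extZ_of_nonneg {I : ℕ} {ψ : Fin I → ℝ → ℝ} {i : Fin I} {u : ℝ} (h : 0 ≤ u) :
    phi (fun j => extZ (ψ j)) i u = phi ψ i u := by
  simp [phi, extZ_of_nonneg h]

theorem phi_extZ_of_neg {I : ℕ} {ψ : Fin I → ℝ → ℝ} {i : Fin I} {u : ℝ} (h : u < 0) :
    phi (fun j => extZ (ψ j)) i u = u := by
  simp [phi, extZ_of_neg h]

theorem phiTop_extZ_of_nonneg {I : ℕ} {ψ : Fin I → ℝ → ℝ} {u : ℝ} (h : 0 ≤ u) :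
    phiTop (fun j => extZ (ψ j)) u = phiTop ψ u := by
  simp [phiTop, extZ_of_nonneg h]

theorem phiTop_extZ_of_neg {I : ℕ} {ψ : Fin I → ℝ → ℝ} {u : ℝ} (h : u < 0) :
    phiTop (fun j => extZ (ψ j)) u = u := by
  simp [phiTop, extZ_of_neg h]

theorem Scattering.extendZero {I : ℕ} {ψ ψb : Fin I → ℝ → ℝ} (h : Scattering (Ici 0) ψ ψb)
    (hpos : ∀ i, ∀ u ∈ Ici (0 : ℝ), 0 ≤ ψ i u) :
    Scattering univ (fun i => extZ (ψ i)) (fun i => extZ (ψb i)) where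
  mono i := by
    intro x _ y _ hxy
    rcases lt_or_ge x 0 with hx | hx
    · rw [extZ_of_neg hx]
      rcases lt_or_ge y 0 with hy | hy
      · rw [extZ_of_neg hy]
      · rw [extZ_of_nonneg hy]; exact hpos i y hy
    · rw [extZ_of_nonneg hx, extZ_of_nonneg (hx.trans hxy)]
      exact h.mono i hx (hx.trans hxy) hxy
  strict_top := by
    intro x _ y _ hxy
    rcases lt_or_ge x 0 with hx | hx
    · rw [phiTop_extZ_of_neg hx]
      rcases lt_or_ge y 0 with hy | hy
      · rwa [phiTop_extZ_of_neg hy]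
      · rw [phiTop_extZ_of_nonneg hy]; exact hx.trans_le (h.mapsTo_top hy)
    · rw [phiTop_extZ_of_nonneg hx, phiTop_extZ_of_nonneg (hx.trans hxy.le)]
      exact h.strict_top hx (hx.trans hxy.le) hxy
  mapsTo_top := mapsTo_univ _ _
  surjOn_top := by
    intro z _
    rcases lt_or_ge z 0 with hz | hz
    · exact ⟨z, trivial, phiTop_extZ_of_neg hz⟩
    · obtain ⟨u, hu, rfl⟩ := h.surjOn_top hz
      exact ⟨u, trivial, phiTop_extZ_of_nonneg hu⟩
  mapsTo _ := mapsTo_univ _ _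
  surjOn i := by
    intro z _
    rcases lt_or_ge z 0 with hz | hz
    · exact ⟨z, trivial, phi_extZ_of_neg hz⟩
    · obtain ⟨u, hu, rfl⟩ := h.surjOn i hz
      exact ⟨u, trivial, phi_extZ_of_nonneg hu⟩
  comp i u _ := by
    rcases lt_or_ge u 0 with hu | hu
    · rw [phi_extZ_of_neg hu, extZ_of_neg hu, extZ_of_neg hu]
    · rw [phi_extZ_of_nonneg hu, extZ_of_nonneg hu, extZ_of_nonneg (h.mapsTo i hu), h.comp i u hu]

/-- The density condition of `memD`, on the domain `A` and with the slopes `c` given. -/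
def SlopeBound {I : ℕ} (A : Set ℝ) (ψ : Fin I → ℝ → ℝ) (c : Fin I → ℝ) : Prop :=
  ∀ i, ∀ u₁ ∈ A, ∀ u₂ ∈ A, u₂ < u₁ → ψ i u₁ - ψ i u₂ ≤ c i * (phi ψ i u₁ - phi ψ i u₂)

theorem Scattering.slopeBound_nonneg {I : ℕ} {A : Set ℝ} (hA : IsUpperSet A) (hne : A.Nonempty)
    {ψ ψb : Fin I → ℝ → ℝ} (h : Scattering A ψ ψb) {c : Fin I → ℝ} (hc : SlopeBound A ψ c)
    (i : Fin I) : 0 ≤ c i := by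
  obtain ⟨u, hu⟩ := hne
  have hlt : u < u + 1 := lt_add_one u
  have hu' : u + 1 ∈ A := hA hlt.le hu
  have h1 := hc i _ hu' _ hu hlt
  have h2 := h.mono i hu hu' hlt.le
  exact nonneg_of_mul_nonneg_left ((sub_nonneg.2 h2).trans h1)
    (sub_pos.2 (h.strict i hu hu' hlt))

theorem SlopeBound.extendZero {I : ℕ} {ψ ψb : Fin I → ℝ → ℝ} (h : Scattering (Ici 0) ψ ψb)
    (h0 : ∀ i, ψ i 0 = 0) {c : Fin I → ℝ} (hc : SlopeBound (Ici 0) ψ c) :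
    SlopeBound univ (fun i => extZ (ψ i)) c := by
  intro i u₁ _ u₂ _ hlt
  have hci := h.slopeBound_nonneg (isUpperSet_Ici 0) nonempty_Ici hc i
  beta_reduce
  rcases lt_or_ge u₂ 0 with h2 | h2
  · rw [phi_extZ_of_neg h2, extZ_of_neg h2]
    rcases lt_or_ge u₁ 0 with h1 | h1
    · rw [phi_extZ_of_neg h1, extZ_of_neg h1, sub_zero]
      exact mul_nonneg hci (sub_pos.2 hlt).le
    · rw [phi_extZ_of_nonneg h1, extZ_of_nonneg h1, sub_zero]
      refine le_trans ?_ (mul_le_mul_of_nonneg_left (show phi ψ i u₁ ≤ _ by linarith) hci)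
      rcases h1.eq_or_lt with rfl | h1'
      · simp [phi, h0]
      · simpa [phi, h0] using hc i u₁ h1 0 self_mem_Ici h1'
  · have h1 := h2.trans hlt.le
    rw [phi_extZ_of_nonneg h2, extZ_of_nonneg h2, phi_extZ_of_nonneg h1, extZ_of_nonneg h1]
    exact hc i u₁ h1 u₂ h2 hlt

theorem hasDerivWithinAt_phi {I : ℕ} {A : Set ℝ} {ψ : Fin I → ℝ → ℝ} {r : Fin I → ℝ} {u : ℝ}
    (h : ∀ i, HasDerivWithinAt (ψ i) (r i) A u) (i : Fin I) :
    HasDerivWithinAt (phi ψ i) (1 - ∑ j, 2 * min (sz i) (sz j) * r j) A u :=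
  (hasDerivWithinAt_id u A).sub (HasDerivWithinAt.fun_sum fun j _ => (h j).const_mul _)

theorem Scattering.deriv_phi_pos {I : ℕ} {A : Set ℝ} (hA : IsUpperSet A) (hAd : UniqueDiffOn ℝ A)
    {ψ ψb : Fin I → ℝ → ℝ} (h : Scattering A ψ ψb) {c : Fin I → ℝ} (hc : SlopeBound A ψ c)
    {r : Fin I → ℝ} {u : ℝ} (hu : u ∈ A) (hr : ∀ i, HasDerivWithinAt (ψ i) (r i) A u)
    (i : Fin I) : 0 < 1 - ∑ j, 2 * min (sz i) (sz j) * r j := by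
  refine one_sub_sum_min_sz_mul_pos (fun i => ?_)
    (h.slopeBound_nonneg hA ⟨u, hu⟩ hc) (fun i => ?_) i
  · rw [← (hr i).derivWithin (hAd u hu)]
    exact (h.mono i).derivWithin_nonneg
  · have hd : HasDerivWithinAt (fun w => c i * phi ψ i w - ψ i w)
        (c i * (1 - ∑ j, 2 * min (sz i) (sz j) * r j) - r i) A u :=
      ((hasDerivWithinAt_phi hr i).const_mul _).sub (hr i)
    have hm : MonotoneOn (fun w => c i * phi ψ i w - ψ i w) A := by
      intro x hx y hy hxy
      rcases hxy.eq_or_lt with rfl | hxy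
      · exact le_rfl
      · have := hc i y hy x hx hxy
        simp only
        linarith
    have := hm.derivWithin_nonneg (x := u)
    rw [hd.derivWithin (hAd u hu)] at this
    linarith

theorem contDiffOn_phi {I : ℕ} {A T : Set ℝ} {ψ : Fin I → ℝ → ℝ → ℝ} {n : ℕ}
    (hψ : ∀ i, ContDiffOn ℝ n (fun p : ℝ × ℝ => ψ i p.1 p.2) (A ×ˢ T)) (i : Fin I) :
    ContDiffOn ℝ n (fun p : ℝ × ℝ => phi (fun j u => ψ j u p.2) i p.1) (A ×ˢ T) := by
  unfold phi
  exact contDiffOn_fst.sub (ContDiffOn.sum fun j _ => contDiffOn_const.mul (hψ j))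

theorem hasDerivWithinAt_slice {A T : Set ℝ} {f : ℝ → ℝ → ℝ} {n : ℕ} (hn : 1 ≤ n)
    (hf : ContDiffOn ℝ n (fun p : ℝ × ℝ => f p.1 p.2) (A ×ˢ T)) {u t : ℝ} (hu : u ∈ A)
    (ht : t ∈ T) : HasDerivWithinAt (fun w => f w t)
      (fderivWithin ℝ (fun p : ℝ × ℝ => f p.1 p.2) (A ×ˢ T) (u, t) (1, 0)) A u :=
  HasFDerivWithinAt.hasDerivWithinAt_fst ht (hf.differentiableOn
    (by exact_mod_cast (by omega : n ≠ 0)) (u, t) ⟨hu, ht⟩).hasFDerivWithinAt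

theorem contDiffOn_scattered {I : ℕ} {A T : Set ℝ} (hA : IsUpperSet A)
    (hAd : UniqueDiffOn ℝ A) (hTd : UniqueDiffOn ℝ T) {n : ℕ} (hn : 1 ≤ n)
    {ψ ψb : Fin I → ℝ → ℝ → ℝ}
    (h : ∀ t ∈ T, Scattering A (fun i u => ψ i u t) (fun i z => ψb i z t))
    (hc : ∀ t ∈ T, ∃ c, SlopeBound A (fun i u => ψ i u t) c)
    (hψ : ∀ i, ContDiffOn ℝ n (fun p : ℝ × ℝ => ψ i p.1 p.2) (A ×ˢ T)) (i : Fin I) :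
    ContDiffOn ℝ n (fun p : ℝ × ℝ => ψb i p.1 p.2) (A ×ˢ T) := by
  set G : ℝ → ℝ → ℝ := fun z t => Function.invFunOn (phi (fun j u => ψ j u t) i) A z
  have hGm : ∀ t ∈ T, ∀ z ∈ A, G z t ∈ A := fun t ht z hz =>
    Function.invFunOn_mem ((h t ht).surjOn i hz)
  have hFG : ∀ t ∈ T, ∀ z ∈ A, phi (fun j u => ψ j u t) i (G z t) = z := fun t ht z hz =>
    Function.invFunOn_eq ((h t ht).surjOn i hz)
  have hGd := contDiffOn_parametric_inverse hA hAd hTd hn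
    (F := fun u t => phi (fun j w => ψ j w t) i u) (G := G) (contDiffOn_phi hψ i)
    (fun t ht => (h t ht).strict i) (fun t ht u hu => by
      obtain ⟨c, hc⟩ := hc t ht
      have hr := fun j => hasDerivWithinAt_slice hn (hψ j) hu ht
      rw [(hasDerivWithinAt_phi hr i).derivWithin (hAd u hu)]
      exact ((h t ht).deriv_phi_pos hA hAd hc hu hr i).ne') hGm hFG
  refine ((hψ i).comp (hGd.prodMk contDiffOn_snd) fun p hp => ⟨hGm _ hp.2 _ hp.1, hp.2⟩).congr ?_
  intro p hp
  have := (h p.2 hp.2).comp i _ (hGm _ hp.2 _ hp.1)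
  rwa [hFG _ hp.2 _ hp.1] at this

theorem contDiffOn_reconstructed {I : ℕ} {A T : Set ℝ} (hA : IsUpperSet A)
    (hAd : UniqueDiffOn ℝ A) (hTd : UniqueDiffOn ℝ T) {n : ℕ} (hn : 1 ≤ n)
    {ψ ψb : Fin I → ℝ → ℝ → ℝ}
    (h : ∀ t ∈ T, Scattering A (fun i u => ψ i u t) (fun i z => ψb i z t))
    (hψb : ∀ i, ContDiffOn ℝ n (fun p : ℝ × ℝ => ψb i p.1 p.2) (A ×ˢ T)) (i : Fin I) :
    ContDiffOn ℝ n (fun p : ℝ × ℝ => ψ i p.1 p.2) (A ×ˢ T) := by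
  set G : ℝ → ℝ → ℝ := fun z t => Function.invFunOn (phiTop (fun j u => ψ j u t)) A z
  have hGm : ∀ t ∈ T, ∀ z ∈ A, G z t ∈ A := fun t ht z hz =>
    Function.invFunOn_mem ((h t ht).surjOn_top hz)
  have hFG : ∀ t ∈ T, ∀ z ∈ A, phiTop (fun j u => ψ j u t) (G z t) = z := fun t ht z hz =>
    Function.invFunOn_eq ((h t ht).surjOn_top hz)
  have hGF : ∀ t ∈ T, ∀ u ∈ A, G (phiTop (fun j u => ψ j u t) u) t = u := fun t ht u hu =>
    (h t ht).strict_top.injOn.leftInvOn_invFunOn hu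
  have hGs : ∀ t ∈ T, StrictMonoOn (fun z => G z t) A := by
    intro t ht x hx y hy hxy
    rwa [← (h t ht).strict_top.lt_iff_lt (hGm t ht x hx) (hGm t ht y hy), hFG t ht x hx,
      hFG t ht y hy]
  have hcomp : ∀ t ∈ T, ∀ z ∈ A, ∀ j,
      ψb j (phi (fun k u => ψ k u t) j (G z t)) t = ψ j (G z t) t := fun t ht z hz j =>
    (h t ht).comp j _ (hGm t ht z hz)
  have hγ : ∀ m : ℕ, ∀ j : Fin I, I - j ≤ m →
      ContDiffOn ℝ n (fun p : ℝ × ℝ => phi (fun k u => ψ k u p.2) j (G p.1 p.2)) (A ×ˢ T) := by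
    intro m
    induction m with
    | zero => intro j hj; omega
    | succ m ih =>
      intro j hj
      have : ContDiffOn ℝ n (fun p : ℝ × ℝ => p.1 + ∑ k, 2 * (sz k - min (sz j) (sz k)) *
          ψb k (phi (fun k u => ψ k u p.2) k (G p.1 p.2)) p.2) (A ×ˢ T) := by
        refine contDiffOn_fst.add (ContDiffOn.sum fun k _ => ?_)
        rcases le_or_gt k j with hkj | hkj
        · simp only [min_eq_right (sz_le_sz hkj), sub_self, mul_zero, zero_mul]
          exact contDiffOn_const
        · exact contDiffOn_const.mul ((hψb k).comp
            ((ih k (by have : (j : ℕ) < k := hkj; omega)).prodMk contDiffOn_snd)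
            fun p hp => ⟨(h _ hp.2).mapsTo k (hGm _ hp.2 _ hp.1), hp.2⟩)
      refine this.congr fun p hp => ?_
      simp only [hcomp _ hp.2 _ hp.1]
      rw [phi_eq_phiTop_add, hFG _ hp.2 _ hp.1]
  have hγ' : ∀ j : Fin I,
      ContDiffOn ℝ n (fun p : ℝ × ℝ => phi (fun k u => ψ k u p.2) j (G p.1 p.2)) (A ×ˢ T) :=
    fun j => hγ I j (by omega)
  have hψG : ∀ j : Fin I, ContDiffOn ℝ n (fun p : ℝ × ℝ => ψ j (G p.1 p.2) p.2) (A ×ˢ T) :=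
    fun j => ((hψb j).comp ((hγ' j).prodMk contDiffOn_snd) fun p hp =>
      ⟨(h _ hp.2).mapsTo j (hGm _ hp.2 _ hp.1), hp.2⟩).congr fun p hp =>
        (hcomp _ hp.2 _ hp.1 j).symm
  have hGeq : ∀ t ∈ T, ∀ z ∈ A, G z t = z + ∑ j, 2 * sz j * ψ j (G z t) t := by
    intro t ht z hz
    have := hFG t ht z hz
    unfold phiTop at this
    linarith
  have hGd : ContDiffOn ℝ n (fun p : ℝ × ℝ => G p.1 p.2) (A ×ˢ T) :=
    (contDiffOn_fst.add (ContDiffOn.sum fun j _ => contDiffOn_const.mul (hψG j))).congr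
      fun p hp => hGeq _ hp.2 _ hp.1
  have hTop : ContDiffOn ℝ n (fun p : ℝ × ℝ => phiTop (fun j u => ψ j u p.2) p.1) (A ×ˢ T) := by
    refine contDiffOn_parametric_inverse hA hAd hTd hn (F := G)
      (G := fun u t => phiTop (fun j w => ψ j w t) u) hGd hGs (fun t ht z hz => ?_)
      (fun t ht u hu => (h t ht).mapsTo_top hu) hGF
    have hd := hasDerivWithinAt_slice hn hGd hz ht
    have hm : MonotoneOn (fun w => G w t - w) A := by
      intro x hx y hy hxy
      simp only
      rw [hGeq t ht x hx, hGeq t ht y hy, add_sub_cancel_left, add_sub_cancel_left]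
      refine Finset.sum_le_sum fun j _ => ?_
      have := (sz_pos j).le
      have := (h t ht).mono j (hGm t ht x hx) (hGm t ht y hy) ((hGs t ht).monotoneOn hx hy hxy)
      gcongr
    have h0 := hm.derivWithin_nonneg (x := z)
    have hsub : HasDerivWithinAt (fun w => G w t - w) _ A z :=
      hd.fun_sub (hasDerivWithinAt_id z A)
    rw [hsub.derivWithin (hAd z hz)] at h0
    rw [hd.derivWithin (hAd z hz)]
    linarith
  refine ((hψG i).comp (hTop.prodMk contDiffOn_snd)
    fun p hp => ⟨(h _ hp.2).mapsTo_top hp.1, hp.2⟩).congr fun p hp => ?_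
  simp only [Function.comp_apply, hGF _ hp.2 _ hp.1]

theorem Scattering.contDiff_extZ_iff {I : ℕ} {ψ ψb : Fin I → ℝ → ℝ}
    (h : Scattering (Ici 0) ψ ψb) (h0 : ∀ i, ψ i 0 = 0)
    (hpos : ∀ i, ∀ u ∈ Ici (0 : ℝ), 0 ≤ ψ i u) {c : Fin I → ℝ} (hc : SlopeBound (Ici 0) ψ c)
    {n : ℕ} (hn : 1 ≤ n) :
    (∀ i, ContDiff ℝ n (extZ (ψ i))) ↔ ∀ i, ContDiff ℝ n (extZ (ψb i)) := by
  have hup : ∀ f : ℝ → ℝ, ContDiff ℝ n f →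
      ContDiffOn ℝ n (fun p : ℝ × ℝ => f p.1) (univ ×ˢ univ) :=
    fun f hf => (hf.comp contDiff_fst).contDiffOn
  have hdown : ∀ f : ℝ → ℝ, ContDiffOn ℝ n (fun p : ℝ × ℝ => f p.1) (univ ×ˢ univ) →
      ContDiff ℝ n f := by
    intro f hf
    rw [univ_prod_univ, contDiffOn_univ] at hf
    exact hf.comp (f := fun w : ℝ => (w, (0 : ℝ))) (contDiff_id.prodMk contDiff_const)
  constructor
  · intro hψ i
    exact hdown _ (contDiffOn_scattered isUpperSet_univ uniqueDiffOn_univ uniqueDiffOn_univ hn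
      (ψ := fun i u _ => extZ (ψ i) u) (ψb := fun i z _ => extZ (ψb i) z)
      (fun _ _ => h.extendZero hpos) (fun _ _ => ⟨c, hc.extendZero h h0⟩) (fun i => hup _ (hψ i)) i)
  · intro hψb i
    exact hdown _ (contDiffOn_reconstructed isUpperSet_univ uniqueDiffOn_univ uniqueDiffOn_univ hn
      (ψ := fun i u _ => extZ (ψ i) u) (ψb := fun i z _ => extZ (ψb i) z)
      (fun _ _ => h.extendZero hpos) (fun i => hup _ (hψb i)) i)

theorem Scattering.slopeBound_iff {I : ℕ} {A : Set ℝ} {ψ ψb : Fin I → ℝ → ℝ}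
    (h : Scattering A ψ ψb) (c : Fin I → ℝ) :
    SlopeBound A ψ c ↔
      ∀ i, ∀ z₁ ∈ A, ∀ z₂ ∈ A, z₂ < z₁ → ψb i z₁ - ψb i z₂ ≤ c i * (z₁ - z₂) := by
  constructor
  · intro hc i z₁ h1 z₂ h2 hlt
    obtain ⟨u₁, hu₁, rfl⟩ := h.surjOn i h1
    obtain ⟨u₂, hu₂, rfl⟩ := h.surjOn i h2
    rw [h.comp i u₁ hu₁, h.comp i u₂ hu₂]
    exact hc i u₁ hu₁ u₂ hu₂ (((h.strict i).lt_iff_lt hu₂ hu₁).1 hlt)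
  · intro hc i u₁ hu₁ u₂ hu₂ hlt
    rw [← h.comp i u₁ hu₁, ← h.comp i u₂ hu₂]
    exact hc i _ (h.mapsTo i hu₁) _ (h.mapsTo i hu₂) (h.strict i hu₂ hu₁ hlt)

theorem Scattering.memC_scattered {I : ℕ} {ψ ψb : Fin I → ℝ → ℝ} (h : Scattering (Ici 0) ψ ψb)
    (hψ : ∀ i, memC (ψ i)) (i : Fin I) : memC (ψb i) := by
  set G : ℝ → ℝ := Function.invFunOn (phi ψ i) (Ici 0)
  have hGm : ∀ z ∈ Ici (0 : ℝ), G z ∈ Ici (0 : ℝ) := fun z hz =>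
    Function.invFunOn_mem (h.surjOn i hz)
  have hFG : ∀ z ∈ Ici (0 : ℝ), phi ψ i (G z) = z := fun z hz =>
    Function.invFunOn_eq (h.surjOn i hz)
  have hcomp : ∀ z ∈ Ici (0 : ℝ), ψb i z = ψ i (G z) := fun z hz => by
    rw [← h.comp i _ (hGm z hz), hFG z hz]
  have hφ : ContinuousOn (phi ψ i) (Ici 0) :=
    continuousOn_id.sub (continuousOn_finsetSum _ fun j _ => continuousOn_const.mul (hψ j).1)
  have hGc : ContinuousOn G (Ici 0) := by
    have := continuousOn_parametric_inverse (isUpperSet_Ici (0 : ℝ)) (T := univ)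
      (F := fun u _ => phi ψ i u) (G := fun z _ => G z)
      (hφ.comp continuousOn_fst fun p hp => hp.1) (fun _ _ => h.strict i)
      (fun _ _ => hGm) (fun _ _ => hFG)
    exact this.comp (f := fun w : ℝ => (w, (0 : ℝ))) (by fun_prop) fun w hw => ⟨hw, trivial⟩
  refine ⟨((hψ i).1.comp hGc hGm).congr hcomp, ?_, ?_, ?_⟩
  · intro x hx y hy hxy
    rw [hcomp x hx, hcomp y hy]
    refine (hψ i).2.1 (hGm x hx) (hGm y hy) ?_
    rwa [← (h.strict i).le_iff_le (hGm x hx) (hGm y hy), hFG x hx, hFG y hy]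
  · have h0 : phi ψ i 0 = 0 := by simp [phi, fun j => (hψ j).2.2.1]
    have := h.comp i 0 self_mem_Ici
    rwa [h0, (hψ i).2.2.1] at this
  · intro z hz
    rw [hcomp z hz]
    exact (hψ i).2.2.2 _ (hGm z hz)

theorem transport_iff {I : ℕ} {A T : Set ℝ} (hA : IsUpperSet A)
    (hAd : UniqueDiffOn ℝ A) (hTd : UniqueDiffOn ℝ T) {n : ℕ} (hn : 1 ≤ n)
    {ψ ψb : Fin I → ℝ → ℝ → ℝ}
    (h : ∀ t ∈ T, Scattering A (fun i u => ψ i u t) (fun i z => ψb i z t))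
    (hψ : ∀ i, ContDiffOn ℝ n (fun p : ℝ × ℝ => ψ i p.1 p.2) (A ×ˢ T))
    (hψb : ∀ i, ContDiffOn ℝ n (fun p : ℝ × ℝ => ψb i p.1 p.2) (A ×ˢ T))
    {u t : ℝ} (hu : u ∈ A) (ht : t ∈ T) {c : Fin I → ℝ}
    (hc : SlopeBound A (fun i u => ψ i u t) c) :
    (∀ i, derivWithin (fun s => ψ i u s) T t
        = -veff (fun j => derivWithin (fun w => ψ j w t) A u) i
            * derivWithin (fun w => ψ i w t) A u) ↔
    ∀ i, derivWithin (fun s => ψb i (phi (fun j w => ψ j w t) i u) s) T t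
        = -sz i * derivWithin (fun w => ψb i w t) A (phi (fun j w => ψ j w t) i u) := by
  have hn' : (n : WithTop ℕ∞) ≠ 0 := by exact_mod_cast (by omega : n ≠ 0)
  have hφm : ∀ i, phi (fun j w => ψ j w t) i u ∈ A := fun i => (h t ht).mapsTo i hu
  have hd := fun i => ((hψ i).differentiableOn hn' (u, t) ⟨hu, ht⟩).hasFDerivWithinAt
  have hdb := fun i => ((hψb i).differentiableOn hn'
    (phi (fun j w => ψ j w t) i u, t) ⟨hφm i, ht⟩).hasFDerivWithinAt
  set L := fun i => fderivWithin ℝ (fun p : ℝ × ℝ => ψ i p.1 p.2) (A ×ˢ T) (u, t)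
  set Lb := fun i => fderivWithin ℝ (fun p : ℝ × ℝ => ψb i p.1 p.2) (A ×ˢ T)
    (phi (fun j w => ψ j w t) i u, t)
  have hx : ∀ i, HasDerivWithinAt (fun w => ψ i w t) (L i (1, 0)) A u := fun i =>
    (hd i).hasDerivWithinAt_fst ht
  have hy : ∀ i, HasDerivWithinAt (fun s => ψ i u s) (L i (0, 1)) T t := fun i =>
    (hd i).hasDerivWithinAt_snd hu
  have hxb := fun i => (hdb i).hasDerivWithinAt_fst (F := ψb i) ht
  have hyb := fun i => (hdb i).hasDerivWithinAt_snd (F := ψb i) (hφm i)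
  simp only [fun i => (hx i).derivWithin (hAd u hu), fun i => (hy i).derivWithin (hTd t ht),
    fun i => (hxb i).derivWithin (hAd _ (hφm i)), fun i => (hyb i).derivWithin (hTd t ht)]
  have hφx : ∀ i, HasDerivWithinAt (fun w => phi (fun j w => ψ j w t) i w)
      (1 - ∑ j, 2 * min (sz i) (sz j) * L j (1, 0)) A u := hasDerivWithinAt_phi hx
  have hφy : ∀ i, HasDerivWithinAt (fun s => phi (fun j w => ψ j w s) i u)
      (-∑ j, 2 * min (sz i) (sz j) * L j (0, 1)) T t := fun i =>
    (HasDerivWithinAt.fun_sum fun j _ => (hy j).const_mul _).const_sub u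
  have hLb_apply : ∀ i (a b : ℝ), Lb i (a, b) = Lb i (1, 0) * a + Lb i (0, 1) * b := by
    intro i a b
    rw [show (a, b) = a • ((1 : ℝ), (0 : ℝ)) + b • ((0 : ℝ), (1 : ℝ)) by ext <;> simp]
    simp only [map_add, map_smul, smul_eq_mul]
    ring
  refine eq_neg_veff_mul_iff (a := fun i => Lb i (1, 0)) (b := fun i => Lb i (0, 1))
    (fun i => ?_) ((h t ht).deriv_phi_pos hA hAd hc hu hx) (fun i => ?_) (fun i => ?_)
  · rw [← (hx i).derivWithin (hAd u hu)]
    exact ((h t ht).mono i).derivWithin_nonneg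
  · have h1 := (hdb i).comp_hasDerivWithinAt (f := fun w => (phi (fun j w => ψ j w t) i w, t)) u
      ((hφx i).prodMk (hasDerivWithinAt_const u A t))
      fun w hw => ⟨(h t ht).mapsTo i hw, ht⟩
    have h2 := (hx i).congr_of_mem (f₁ := (fun p : ℝ × ℝ => ψb i p.1 p.2) ∘
      fun w => (phi (fun j w => ψ j w t) i w, t)) (fun w hw => (h t ht).comp i w hw) hu
    have h3 := (hAd u hu).eq_deriv _ h2 h1
    rw [hLb_apply] at h3
    linarith
  · have h1 := (hdb i).comp_hasDerivWithinAt (f := fun s => (phi (fun j w => ψ j w s) i u, s)) t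
      ((hφy i).prodMk (hasDerivWithinAt_id t T))
      fun s hs => ⟨(h s hs).mapsTo i hu, hs⟩
    have h2 := (hy i).congr_of_mem (f₁ := (fun p : ℝ × ℝ => ψb i p.1 p.2) ∘
      fun s => (phi (fun j w => ψ j w s) i u, s)) (fun s hs => (h s hs).comp i u hu) ht
    have h3 := (hTd t ht).eq_deriv _ h2 h1
    rw [hLb_apply] at h3
    linarith

/-- with `ψ(·,t) ∈ 𝓕` for all `t ∈ ℝ₊` and `ψb(·,t) := Υ(ψ(·,t))`,
the following are equivalent: (i) `ψ(·,t) ∈ 𝒟^q` for all `t`, each `ψ_i ∈ C^q(ℝ₊²,ℝ₊)`,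
and `∂_t ψ_i = -v_i^eff(∂_u ψ) ∂_u ψ_i` on `ℝ₊²`; (ii) `ψb(·,t) ∈ 𝒟̄^q` for all `t`,
each `ψb_i ∈ C^q(ℝ₊²,ℝ₊)`, and `∂_t ψb_i = -i ∂_z ψb_i` on `ℝ₊²`. -/
theorem stmt_17 {I : ℕ} (hI : 1 ≤ I) (q : ℕ) (hq : 1 ≤ q)
    (ψ : Fin I → ℝ → ℝ → ℝ)
    (hF : ∀ t ∈ Ici (0:ℝ), memF (fun i u => ψ i u t))
    (ψb : Fin I → ℝ → ℝ → ℝ)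
    (hψb : ∀ i z t, ψb i z t = Upsilon (fun j u => ψ j u t) i z) :
    ((∀ t ∈ Ici (0:ℝ),
        memD (fun i u => ψ i u t) ∧ ∀ i, memCq q (fun u => ψ i u t)) ∧
     (∀ i, memCqTwo q (ψ i)) ∧
     (∀ i, ∀ u ∈ Ici (0:ℝ), ∀ t ∈ Ici (0:ℝ),
        derivWithin (fun s => ψ i u s) (Ici 0) t
          = - veff (fun j => derivWithin (fun w => ψ j w t) (Ici 0) u) i
              * derivWithin (fun w => ψ i w t) (Ici 0) u))
    ↔
    ((∀ t ∈ Ici (0:ℝ),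
        memDbar (fun i z => ψb i z t) ∧ ∀ i, memCq q (fun z => ψb i z t)) ∧
     (∀ i, memCqTwo q (ψb i)) ∧
     (∀ i, ∀ z ∈ Ici (0:ℝ), ∀ t ∈ Ici (0:ℝ),
        derivWithin (fun s => ψb i z s) (Ici 0) t
          = - sz i * derivWithin (fun w => ψb i w t) (Ici 0) z)) := by
  have hS : ∀ t ∈ Ici (0:ℝ), Scattering (Ici 0) (fun i u => ψ i u t) (fun i z => ψb i z t) :=
    fun t ht => (hF t ht).scattering fun i z => hψb i z t
  have hmemC : ∀ t ∈ Ici (0:ℝ), ∀ i, memC (fun z => ψb i z t) :=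
    fun t ht => (hS t ht).memC_scattered (hF t ht).1
  have hA := isUpperSet_Ici (0:ℝ)
  have hU := uniqueDiffOn_Ici (0:ℝ)
  have hext : ∀ t ∈ Ici (0:ℝ), ∀ c, SlopeBound (Ici 0) (fun i u => ψ i u t) c →
      ((∀ i, ContDiff ℝ q (extZ fun u => ψ i u t)) ↔
        ∀ i, ContDiff ℝ q (extZ fun z => ψb i z t)) := fun t ht c hc =>
    (hS t ht).contDiff_extZ_iff (fun i => ((hF t ht).1 i).2.2.1)
      (fun i => ((hF t ht).1 i).2.2.2) hc hq
  constructor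
  · rintro ⟨hD, hC, hpde⟩
    have hc : ∀ t ∈ Ici (0:ℝ), ∃ c, SlopeBound (Ici 0) (fun i u => ψ i u t) c :=
      fun t ht => (hD t ht).1.2.imp fun c hc => hc.1
    have hCb := contDiffOn_scattered hA hU hU hq hS hc fun i => (hC i).2
    refine ⟨fun t ht => ?_, fun i => ⟨fun z hz t ht => (hmemC t ht i).2.2.2 z hz, hCb i⟩, ?_⟩
    · obtain ⟨⟨-, c, hsl, hsum⟩, hCq⟩ := hD t ht
      exact ⟨⟨hmemC t ht, c, ((hS t ht).slopeBound_iff c).1 hsl, hsum⟩, fun i =>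
        ⟨hmemC t ht i, (hext t ht c hsl).1 (fun i => (hCq i).2) i⟩⟩
    · intro i z hz t ht
      obtain ⟨u, hu, rfl⟩ := (hS t ht).surjOn i hz
      obtain ⟨c, hc⟩ := hc t ht
      exact (transport_iff hA hU hU hq hS (fun i => (hC i).2) hCb hu ht hc).1
        (fun i => hpde i u hu t ht) i
  · rintro ⟨hD, hC, hpde⟩
    have hc : ∀ t ∈ Ici (0:ℝ), ∃ c, SlopeBound (Ici 0) (fun i u => ψ i u t) c :=
      fun t ht => (hD t ht).1.2.imp fun c hc => ((hS t ht).slopeBound_iff c).2 hc.1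
    have hCψ := contDiffOn_reconstructed hA hU hU hq hS fun i => (hC i).2
    refine ⟨fun t ht => ?_,
      fun i => ⟨fun u hu t ht => ((hF t ht).1 i).2.2.2 u hu, hCψ i⟩, ?_⟩
    · obtain ⟨⟨-, c, hsl, hsum⟩, hCq⟩ := hD t ht
      have hsl := ((hS t ht).slopeBound_iff c).2 hsl
      exact ⟨⟨hF t ht, c, hsl, hsum⟩, fun i =>
        ⟨(hF t ht).1 i, (hext t ht c hsl).2 (fun i => (hCq i).2) i⟩⟩
    · intro i u hu t ht
      obtain ⟨c, hc⟩ := hc t ht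
      exact (transport_iff hA hU hU hq hS hCψ (fun i => (hC i).2) hu ht hc).2
        (fun j => hpde j _ ((hS t ht).mapsTo j hu) t ht) i
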